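/- Let $1 < q \le p \le \infty$ and $\phi \in \mathcal{G}_{q,p}$. Assume there is a constant $C > 0$ such that for every $r > 0$, $\int_r^\infty \phi^q(t)\, t^{\frac{dq}{p} - 1}\, dt \le C\, \phi^q(r)\, r^{\frac{dq}{p}}$. Then there exists a constant $C' > 0$ such that for every $f \in (L^q,L^p)^\phi(\mathbb{R}^d)$, $\|Mf\|_{(L^q,L^p)^\phi} \le C'\, \|f\|_{(L^q,L^p)^\phi}$, where $M$ is the Hardy–Littlewood maximal operator. -/

import Mathlib

open MeasureTheory ENNReal Set Metric Filter

noncomputable section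

/-- Shorthand for the Euclidean space `ℝ^d`. -/
abbrev Rd (d : ℕ) := EuclideanSpace ℝ (Fin d)

/-- The `L^p` "norm" (with values in `ℝ≥0∞`) of an `ℝ≥0∞`-valued function. -/
def eLpNormE {α : Type*} [MeasurableSpace α] (g : α → ℝ≥0∞) (p : ℝ≥0∞) (μ : Measure α) :
    ℝ≥0∞ :=
  if p = ∞ then essSup g μ else (∫⁻ x, g x ^ p.toReal ∂μ) ^ (1 / p.toReal)

/-- The discrete `ℓ^p` norm of an `ℝ≥0∞`-valued family. -/
def lpNormE {ι : Type*} (a : ι → ℝ≥0∞) (p : ℝ≥0∞) : ℝ≥0∞ :=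
  if p = ∞ then ⨆ k, a k else (∑' k, a k ^ p.toReal) ^ (1 / p.toReal)

/-- The continuous amalgam norm `‖f‖_{q,p,r}` of `f : ℝ^d → E`:
the `L^p` norm (in `y`) of `y ↦ ‖f · χ_{B(y,r)}‖_{L^q}`. -/
def contAmalgam (d : ℕ) {E : Type*} [NormedAddCommGroup E] (f : Rd d → E)
    (q p : ℝ≥0∞) (r : ℝ) : ℝ≥0∞ :=
  eLpNormE (fun y => eLpNorm ((Metric.ball y r).indicator f) q volume) p volume

/-- The continuous amalgam norm of an `ℝ≥0∞`-valued function. -/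
def contAmalgamE (d : ℕ) (g : Rd d → ℝ≥0∞) (q p : ℝ≥0∞) (r : ℝ) : ℝ≥0∞ :=
  eLpNormE (fun y => eLpNormE ((Metric.ball y r).indicator g) q volume) p volume

/-- The half-open cube `Q_k^r = ∏_i [r kᵢ, r (kᵢ + 1))` indexed by `k ∈ ℤ^d`. -/
def unitCube (d : ℕ) (r : ℝ) (k : Fin d → ℤ) : Set (Rd d) :=
  {x | ∀ i, r * k i ≤ x i ∧ x i < r * (k i + 1)}

/-- The discrete amalgam norm: the `ℓ^p` norm over `k ∈ ℤ^d` of `‖f χ_{Q_k^r}‖_{L^q}`. -/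
def discAmalgam (d : ℕ) {E : Type*} [NormedAddCommGroup E] (f : Rd d → E)
    (q p : ℝ≥0∞) (r : ℝ) : ℝ≥0∞ :=
  lpNormE (fun k : Fin d → ℤ => eLpNorm ((unitCube d r k).indicator f) q volume) p

/-- The class `𝒢_{q,p}` of weight functions: `φ` is positive and measurable on `(0,∞)`,
`t ↦ t^{d/p} φ(t)` is almost decreasing and `t ↦ t^{d/q} φ(t)` is almost increasing
(with the convention `1/∞ = 0`). -/
structure IsGqp (d : ℕ) (q p : ℝ≥0∞) (φ : ℝ → ℝ) : Prop where
  measurable : Measurable φ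
  pos : ∀ t : ℝ, 0 < t → 0 < φ t
  almost_decreasing : ∃ C : ℝ, 0 < C ∧ ∀ r s : ℝ, 0 < r → r ≤ s →
    s ^ ((d : ℝ) * (1 / p).toReal) * φ s ≤ C * (r ^ ((d : ℝ) * (1 / p).toReal) * φ r)
  almost_increasing : ∃ C : ℝ, 0 < C ∧ ∀ r s : ℝ, 0 < r → r ≤ s →
    r ^ ((d : ℝ) * (1 / q).toReal) * φ r ≤ C * (s ^ ((d : ℝ) * (1 / q).toReal) * φ s)

/-- The generalized Fofana norm
`‖f‖_{(L^q,L^p)^φ} = sup_{r>0} φ(r)⁻¹ r^{d(-1/q - 1/p)} ‖f‖_{q,p,r}`. -/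
def fofanaNorm (d : ℕ) {E : Type*} [NormedAddCommGroup E] (f : Rd d → E)
    (q p : ℝ≥0∞) (φ : ℝ → ℝ) : ℝ≥0∞ :=
  ⨆ r : {r : ℝ // 0 < r},
    ENNReal.ofReal ((φ r)⁻¹ * (r : ℝ) ^ ((d : ℝ) * (-(1 / q).toReal - (1 / p).toReal))) *
      contAmalgam d f q p r

/-- The generalized Fofana norm of an `ℝ≥0∞`-valued function. -/
def fofanaNormE (d : ℕ) (g : Rd d → ℝ≥0∞) (q p : ℝ≥0∞) (φ : ℝ → ℝ) : ℝ≥0∞ :=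
  ⨆ r : {r : ℝ // 0 < r},
    ENNReal.ofReal ((φ r)⁻¹ * (r : ℝ) ^ ((d : ℝ) * (-(1 / q).toReal - (1 / p).toReal))) *
      contAmalgamE d g q p r

/-- The discrete variant of the generalized Fofana norm,
`sup_{r>0} φ(r)⁻¹ r^{-d/q} ‖f‖~_{q,p,r}`. -/
def fofanaNormDisc (d : ℕ) {E : Type*} [NormedAddCommGroup E] (f : Rd d → E)
    (q p : ℝ≥0∞) (φ : ℝ → ℝ) : ℝ≥0∞ :=
  ⨆ r : {r : ℝ // 0 < r},
    ENNReal.ofReal ((φ r)⁻¹ * (r : ℝ) ^ (-(d : ℝ) * (1 / q).toReal)) *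
      discAmalgam d f q p r

/-- The Hardy–Littlewood maximal function (with values in `ℝ≥0∞`). -/
def hlMax (d : ℕ) {E : Type*} [NormedAddCommGroup E] (f : Rd d → E) (x : Rd d) : ℝ≥0∞ :=
  ⨆ r : {r : ℝ // 0 < r},
    (volume (Metric.ball x (r : ℝ)))⁻¹ * ∫⁻ y in Metric.ball x (r : ℝ), (‖f y‖₊ : ℝ≥0∞)


theorem decay_aux (s e C K : ℝ) (hs : 0 ≤ s) (hC : 0 < C) (hK : 0 < K)
    (φ : ℝ → ℝ) (hpos : ∀ t : ℝ, 0 < t → 0 < φ t)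
    (hdec : ∀ r s : ℝ, 0 < r → r ≤ s → s ^ e * φ s ≤ K * (r ^ e * φ r))
    (r Λ : ℝ) (hr : 0 < r) (hΛ : 1 ≤ Λ)
    (hint : (∫⁻ t in Set.Ioi r, ENNReal.ofReal (φ t ^ s * t ^ (e * s - 1))) ≤
        ENNReal.ofReal (C * (φ r ^ s * r ^ (e * s)))) :
    (((Λ * r) ^ e * φ (Λ * r)) / K) ^ s * Real.log Λ ≤ C * (r ^ e * φ r) ^ s := by
  have hΛ0 : 0 < Λ := by linarith
  have hle : r ≤ Λ * r := by nlinarith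
  set P := (Λ * r) ^ e * φ (Λ * r) with hP
  have hP0 : 0 < P := mul_pos (Real.rpow_pos_of_pos (by positivity) _) (hpos _ (by positivity))
  have key : ENNReal.ofReal ((P / K) ^ s * Real.log Λ) ≤
      ∫⁻ t in Set.Ioi r, ENNReal.ofReal (φ t ^ s * t ^ (e * s - 1)) := by
    calc ENNReal.ofReal ((P / K) ^ s * Real.log Λ)
        = ∫⁻ t in Set.Ioc r (Λ * r), ENNReal.ofReal ((P / K) ^ s * t⁻¹) := by
          rw [← ofReal_integral_eq_lintegral_ofReal]
          · rw [← intervalIntegral.integral_of_le hle, intervalIntegral.integral_const_mul,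
              integral_inv_of_pos hr (by positivity), mul_div_cancel_right₀ _ hr.ne']
          · rw [← IntegrableOn, ← intervalIntegrable_iff_integrableOn_Ioc_of_le hle]
            apply IntervalIntegrable.const_mul
            rw [intervalIntegrable_inv_iff]
            right
            rw [Set.uIcc_of_le hle]
            intro h
            exact absurd h.1 (not_le.2 hr)
          · filter_upwards [ae_restrict_mem measurableSet_Ioc] with t ht
            have : 0 < t := hr.trans ht.1
            simp only [Pi.zero_apply]
            positivity
      _ ≤ ∫⁻ t in Set.Ioc r (Λ * r), ENNReal.ofReal (φ t ^ s * t ^ (e * s - 1)) := by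
          apply setLIntegral_mono' measurableSet_Ioc
          intro t ht
          apply ENNReal.ofReal_le_ofReal
          have ht0 : 0 < t := hr.trans ht.1
          have h1 : P / K ≤ t ^ e * φ t := by
            rw [div_le_iff₀ hK, mul_comm]
            exact hdec t _ ht0 ht.2
          rw [Real.rpow_sub ht0, Real.rpow_one, div_eq_mul_inv (t ^ (e * s)), ← mul_assoc, Real.rpow_mul ht0.le,
            ← Real.mul_rpow (hpos t ht0).le (by positivity), mul_comm (φ t)]
          gcongr
      _ ≤ _ := lintegral_mono_set Set.Ioc_subset_Ioi_self
  have h2 := key.trans hint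
  have h3 : 0 < r ^ e := by positivity
  have h4 := hpos r hr
  rw [ENNReal.ofReal_le_ofReal_iff (by positivity), Real.rpow_mul hr.le,
    ← Real.mul_rpow h4.le h3.le, mul_comm (φ r)] at h2
  exact h2

theorem decay (s e C K : ℝ) (hs : 0 < s) (hC : 0 < C) (hK : 0 < K)
    (φ : ℝ → ℝ) (hpos : ∀ t : ℝ, 0 < t → 0 < φ t)
    (hdec : ∀ r s : ℝ, 0 < r → r ≤ s → s ^ e * φ s ≤ K * (r ^ e * φ r))
    (hint : ∀ r, 0 < r → (∫⁻ t in Set.Ioi r, ENNReal.ofReal (φ t ^ s * t ^ (e * s - 1))) ≤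
        ENNReal.ofReal (C * (φ r ^ s * r ^ (e * s)))) :
    ∃ Λ : ℝ, 2 ≤ Λ ∧ ∀ r, 0 < r → ∀ k : ℕ,
      (Λ ^ k * r) ^ e * φ (Λ ^ k * r) ≤ (1 / 2) ^ k * (r ^ e * φ r) := by
  have hL : 0 < C * (2 * K) ^ s := by positivity
  refine ⟨Real.exp (C * (2 * K) ^ s + 1), ?_, ?_⟩
  · have := Real.add_one_le_exp (C * (2 * K) ^ s + 1)
    linarith
  set Λ := Real.exp (C * (2 * K) ^ s + 1) with hΛ
  have hΛ1 : 1 ≤ Λ := Real.one_le_exp (by linarith)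
  have step : ∀ r, 0 < r → (Λ * r) ^ e * φ (Λ * r) ≤ (1 / 2) * (r ^ e * φ r) := by
    intro r hr
    have h := decay_aux s e C K hs.le hC hK φ hpos hdec r Λ hr hΛ1 (hint r hr)
    have hΛr : 0 < Λ * r := by positivity
    have hP0 : 0 < (Λ * r) ^ e * φ (Λ * r) := mul_pos (by positivity) (hpos _ hΛr)
    have hR0 : 0 < r ^ e * φ r := mul_pos (by positivity) (hpos _ hr)
    set P := (Λ * r) ^ e * φ (Λ * r)
    rw [hΛ, Real.log_exp] at h
    have h1 : (P / K) ^ s * (C * (2 * K) ^ s) ≤ C * (r ^ e * φ r) ^ s := by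
      refine le_trans ?_ h
      gcongr
      linarith
    have h2 : (P / K) ^ s * (C * (2 * K) ^ s) = C * (2 * P) ^ s := by
      rw [mul_left_comm, ← Real.mul_rpow (by positivity) (by positivity)]
      congr 2
      field_simp
    rw [h2, mul_le_mul_iff_right₀ hC, Real.rpow_le_rpow_iff (by positivity) hR0.le hs] at h1
    linarith
  intro r hr k
  induction k with
  | zero => simp
  | succ k ih =>
    have := step (Λ ^ k * r) (by positivity)
    rw [← mul_assoc, ← pow_succ'] at this
    rw [pow_succ' (1 / 2 : ℝ)]
    linarith

theorem weak_half {d : ℕ} (g : Rd d → ℝ≥0∞) (K : Set (Rd d)) (hK : IsCompact K) (l : ℝ≥0∞)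
    (h : ∀ x ∈ K, ∃ z : Rd d, ∃ r : ℝ, 0 < r ∧ x ∈ Metric.ball z r ∧
      l * volume (Metric.ball z r) ≤ ∫⁻ y in Metric.ball z r, g y) :
    l * volume K ≤ 5 ^ d * ∫⁻ y, g y := by
  choose! z r hr hx hl using h
  obtain ⟨t, htK, ht⟩ := hK.elim_nhds_subcover (fun x => Metric.ball (z x) (r x))
    (fun x hxK => Metric.isOpen_ball.mem_nhds (hx x hxK))
  obtain ⟨u, hut, hdisj, hcov⟩ := Vitali.exists_disjoint_subfamily_covering_enlargement_ball
    (t : Set (Rd d)) z r (∑ x ∈ t, r x)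
    (fun a ha => Finset.single_le_sum (f := r) (fun i hi => (hr i (htK i hi)).le) ha) 5 (by norm_num)
  have hufin : u.Finite := t.finite_toSet.subset hut
  have hsub : K ⊆ ⋃ b ∈ u, Metric.ball (z b) (5 * r b) := by
    intro x hxK
    obtain ⟨a, ha, hxa⟩ := Set.mem_iUnion₂.1 (ht hxK)
    obtain ⟨b, hb, hab⟩ := hcov a ha
    exact Set.mem_iUnion₂.2 ⟨b, hb, hab hxa⟩
  calc l * volume K ≤ l * ∑' b : u, volume (Metric.ball (z b) (5 * r b)) := by
        gcongr
        exact (measure_mono hsub).trans (measure_biUnion_le _ hufin.countable _)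
    _ = 5 ^ d * ∑' b : u, l * volume (Metric.ball (z b) (r b)) := by
        rw [← ENNReal.tsum_mul_left, ← ENNReal.tsum_mul_left]
        congr 1
        ext b
        rw [Measure.addHaar_ball_mul_of_pos _ _ (by norm_num : (0:ℝ) < 5),
          Measure.addHaar_ball_center _ (z b) (r b)]
        simp only [finrank_euclideanSpace, Fintype.card_fin]
        rw [ENNReal.ofReal_pow (by norm_num)]
        simp only [ENNReal.ofReal_ofNat]
        ring
    _ ≤ 5 ^ d * ∑' b : u, ∫⁻ y in Metric.ball (z b) (r b), g y := by
        gcongr with b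
        exact hl b (htK b (hut b.2))
    _ = 5 ^ d * ∫⁻ y in ⋃ b ∈ u, Metric.ball (z b) (r b), g y := by
        rw [lintegral_biUnion hufin.countable (fun b _ => Metric.isOpen_ball.measurableSet) hdisj]
    _ ≤ 5 ^ d * ∫⁻ y, g y := by
        gcongr
        exact Measure.restrict_le_self

/-- uncentred maximal function -/
def uMax {d : ℕ} (g : Rd d → ℝ≥0∞) (x : Rd d) : ℝ≥0∞ :=
  ⨆ b : Rd d × {r : ℝ // 0 < r}, (Metric.ball b.1 b.2.1).indicator
    (fun _ => (volume (Metric.ball b.1 b.2.1))⁻¹ * ∫⁻ y in Metric.ball b.1 b.2.1, g y) x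

theorem uMax_lsc {d : ℕ} (g : Rd d → ℝ≥0∞) : LowerSemicontinuous (uMax g) := by
  unfold uMax
  apply lowerSemicontinuous_iSup
  intro b
  exact Metric.isOpen_ball.lowerSemicontinuous_indicator (zero_le)

theorem weak_type {d : ℕ} (g : Rd d → ℝ≥0∞) (l : ℝ≥0∞) :
    l * volume {x | l < uMax g x} ≤ 5 ^ d * ∫⁻ y, g y := by
  have ho : IsOpen {x | l < uMax g x} := (uMax_lsc g).isOpen_preimage l
  rw [ho.measure_eq_iSup_isCompact, ENNReal.mul_iSup]
  refine iSup_le fun K => ?_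
  rw [ENNReal.mul_iSup]
  refine iSup_le fun hKs => ?_
  rw [ENNReal.mul_iSup]
  refine iSup_le fun hK => ?_
  apply weak_half g K hK l
  intro x hx
  have : l < uMax g x := hKs hx
  obtain ⟨b, hb⟩ := lt_iSup_iff.1 this
  by_cases hxb : x ∈ Metric.ball b.1 b.2.1
  · refine ⟨b.1, b.2.1, b.2.2, hxb, ?_⟩
    rw [Set.indicator_of_mem hxb] at hb
    rw [mul_comm] at hb
    rw [← ENNReal.le_div_iff_mul_le (Or.inl (Metric.measure_ball_pos _ _ b.2.2).ne')
      (Or.inl measure_ball_lt_top.ne), div_eq_mul_inv]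
    exact hb.le
  · rw [Set.indicator_of_notMem hxb] at hb
    exact absurd hb _root_.not_lt_zero

theorem lc_fin (s a : ℝ) (hs : 0 < s) (ha : 0 ≤ a) :
    ∫⁻ t in Set.Ioo 0 a, ENNReal.ofReal (s * t ^ (s - 1)) = ENNReal.ofReal (a ^ s) := by
  rw [setLIntegral_congr Ioo_ae_eq_Ioc, ← ofReal_integral_eq_lintegral_ofReal]
  · rw [← intervalIntegral.integral_of_le ha, intervalIntegral.integral_const_mul,
      integral_rpow (Or.inl (by linarith))]
    congr 1
    rw [sub_add_cancel, Real.zero_rpow hs.ne', sub_zero]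
    field_simp
  · rw [← IntegrableOn, ← intervalIntegrable_iff_integrableOn_Ioc_of_le ha]
    exact (intervalIntegral.intervalIntegrable_rpow' (by linarith)).const_mul _
  · filter_upwards [ae_restrict_mem measurableSet_Ioc] with t ht
    have : 0 < t := ht.1
    simp only [Pi.zero_apply]
    positivity

theorem layer (s : ℝ) (hs : 0 < s) (a : ℝ≥0∞) :
    ∫⁻ t in Set.Ioi (0 : ℝ), {t : ℝ | ENNReal.ofReal t < a}.indicator
      (fun t => ENNReal.ofReal (s * t ^ (s - 1))) t = a ^ s := by
  have hm : MeasurableSet {t : ℝ | ENNReal.ofReal t < a} :=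
    measurableSet_lt ENNReal.measurable_ofReal measurable_const
  rw [lintegral_indicator hm, Measure.restrict_restrict hm]
  by_cases ha : a = ∞
  · subst ha
    rw [ENNReal.top_rpow_of_pos hs]
    have : {t : ℝ | ENNReal.ofReal t < ∞} ∩ Set.Ioi 0 = Set.Ioi 0 := by ext; simp
    rw [this]
    rw [eq_top_iff]
    apply le_of_forall_lt
    intro c hc
    lift c to NNReal using hc.ne
    set b : ℝ := ((c : ℝ) + 1) ^ (1 / s)
    calc (c : ℝ≥0∞) < ENNReal.ofReal (b ^ s) := by
          rw [← Real.rpow_mul (by positivity), one_div_mul_cancel hs.ne', Real.rpow_one]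
          rw [← ENNReal.ofReal_coe_nnreal]
          exact (ENNReal.ofReal_lt_ofReal_iff (by positivity)).2 (by linarith)
      _ = _ := (lc_fin s b hs (by positivity)).symm
      _ ≤ _ := lintegral_mono_set Set.Ioo_subset_Ioi_self
  · lift a to NNReal using ha
    have : {t : ℝ | ENNReal.ofReal t < a} ∩ Set.Ioi 0 = Set.Ioo 0 (a : ℝ) := by
      ext t
      simp only [Set.mem_inter_iff, Set.mem_ofPred_eq, Set.mem_Ioi, Set.mem_Ioo]
      constructor
      · rintro ⟨h1, h2⟩
        exact ⟨h2, by rwa [← ENNReal.ofReal_coe_nnreal, ENNReal.ofReal_lt_ofReal_iff_of_nonneg h2.le] at h1⟩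
      · rintro ⟨h1, h2⟩
        exact ⟨by rwa [← ENNReal.ofReal_coe_nnreal, ENNReal.ofReal_lt_ofReal_iff_of_nonneg h1.le], h1⟩
    rw [this, lc_fin s a hs a.2, ← ENNReal.ofReal_rpow_of_nonneg (NNReal.coe_nonneg a) hs.le,
      ENNReal.ofReal_coe_nnreal]

theorem layer_int {d : ℕ} (s : ℝ) (hs : 0 < s) (h w : Rd d → ℝ≥0∞) (hh : Measurable h)
    (hw : Measurable w) :
    ∫⁻ x, w x * h x ^ s = ∫⁻ t in Set.Ioi (0 : ℝ),
      ENNReal.ofReal (s * t ^ (s - 1)) * ∫⁻ x in {x | ENNReal.ofReal t < h x}, w x := by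
  have e1 : ∀ x, w x * h x ^ s = ∫⁻ t in Set.Ioi (0 : ℝ),
      {z : Rd d × ℝ | ENNReal.ofReal z.2 < h z.1}.indicator
        (fun z => w z.1 * ENNReal.ofReal (s * z.2 ^ (s - 1))) (x, t) := by
    intro x
    rw [← layer s hs (h x), ← lintegral_const_mul]
    · congr 1
      ext t
      by_cases ht : ENNReal.ofReal t < h x <;> simp [Set.indicator, ht]
    · apply Measurable.indicator (by fun_prop)
      exact measurableSet_lt ENNReal.measurable_ofReal measurable_const
  simp_rw [e1]
  rw [lintegral_lintegral_swap]
  · congr 1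
    ext t
    have hm : MeasurableSet {x | ENNReal.ofReal t < h x} := measurableSet_lt measurable_const hh
    rw [← lintegral_indicator hm, ← lintegral_const_mul]
    · congr 1
      ext x
      by_cases ht : ENNReal.ofReal t < h x <;> simp [Set.indicator, ht, mul_comm]
    · exact hw.indicator hm
  · apply Measurable.aemeasurable
    have : MeasurableSet {z : Rd d × ℝ | ENNReal.ofReal z.2 < h z.1} :=
      measurableSet_lt (by fun_prop) (by fun_prop)
    have h2 : Measurable (fun z : Rd d × ℝ => w z.1 * ENNReal.ofReal (s * z.2 ^ (s - 1))) := by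
      fun_prop
    exact h2.indicator this

theorem uMax_add_const {d : ℕ} (g g₁ : Rd d → ℝ≥0∞) (l : ℝ≥0∞) (h : ∀ x, g x ≤ g₁ x + l) (x : Rd d) :
    uMax g x ≤ uMax g₁ x + l := by
  unfold uMax
  refine iSup_le fun b => ?_
  by_cases hxb : x ∈ Metric.ball b.1 b.2.1
  · refine le_trans ?_ (add_le_add (le_iSup _ b) le_rfl)
    simp only [Set.indicator_of_mem hxb]
    have h0 := (Metric.measure_ball_pos (volume : Measure (Rd d)) b.1 b.2.2).ne'
    have h1 := (measure_ball_lt_top (μ := (volume : Measure (Rd d))) (x := b.1) (r := b.2.1)).ne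
    calc _ ≤ (volume (ball b.1 b.2.1))⁻¹ * ∫⁻ y in ball b.1 b.2.1, (g₁ y + l) := by
          gcongr; exact h _
      _ = _ := by
          rw [lintegral_add_right _ measurable_const, lintegral_const, mul_add,
            Measure.restrict_apply_univ, mul_left_comm, ENNReal.inv_mul_cancel h0 h1, mul_one]
  · rw [Set.indicator_of_notMem hxb]; exact zero_le

theorem weak_trunc {d : ℕ} (g : Rd d → ℝ≥0∞) (hg : Measurable g) (l : ℝ≥0∞) :
    l * volume {x | l < uMax g x / 2} ≤ 5 ^ d * ∫⁻ y in {y | l < g y}, g y := by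
  have hm : MeasurableSet {y | l < g y} := measurableSet_lt measurable_const hg
  rw [← lintegral_indicator hm]
  refine le_trans ?_ (weak_type _ l)
  refine mul_le_mul_right (measure_mono fun x hx => ?_) _
  simp only [Set.mem_ofPred_eq] at hx ⊢
  rw [ENNReal.lt_div_iff_mul_lt (by simp) (by simp), mul_two] at hx
  have := hx.trans_le (uMax_add_const g ({y | l < g y}.indicator g) l (fun y => by
    by_cases hy : l < g y
    · rw [Set.indicator_of_mem (by exact hy)]; exact le_self_add
    · rw [Set.indicator_of_notMem (by exact hy), zero_add]; exact not_lt.1 hy) x)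
  exact lt_of_add_lt_add_right this

theorem strong_type {d : ℕ} (s : ℝ) (hs : 1 < s) (g : Rd d → ℝ≥0∞) (hg : Measurable g) :
    ∫⁻ x, uMax g x ^ s ≤
      (2 ^ s * (5 ^ d * ENNReal.ofReal (s / (s - 1)))) * ∫⁻ x, g x ^ s := by
  have hM : Measurable (uMax g) := (uMax_lsc g).measurable
  have hs0 : 0 < s := by linarith
  have hs1 : 0 < s - 1 := by linarith
  have e1 : ∫⁻ x, uMax g x ^ s = 2 ^ s * ∫⁻ x, 1 * (uMax g x / 2) ^ s := by
    rw [← lintegral_const_mul _ (by fun_prop)]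
    congr 1
    ext x
    rw [one_mul, ← ENNReal.mul_rpow_of_nonneg _ _ hs0.le, ENNReal.mul_div_cancel (by simp) (by simp)]
  have e2 : ∫⁻ x, g x ^ s = ∫⁻ x, g x * g x ^ (s - 1) := by
    congr 1
    ext x
    conv_rhs => rw [← ENNReal.rpow_one (g x), ← ENNReal.rpow_mul, one_mul]
    rw [← ENNReal.rpow_add_of_nonneg _ _ zero_le_one hs1.le]
    congr 1; ring
  rw [e1, e2, layer_int s hs0 _ _ (hM.div_const 2) measurable_const, layer_int (s - 1) hs1 _ _ hg hg,
    mul_assoc]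
  gcongr
  rw [← lintegral_const_mul' _ _ (by finiteness)]
  apply setLIntegral_mono' measurableSet_Ioi
  intro t ht
  have ht0 : 0 < t := ht
  rw [setLIntegral_one]
  have h1 := weak_trunc g hg (ENNReal.ofReal t)
  have h2 : ENNReal.ofReal (s * t ^ (s - 1)) =
      ENNReal.ofReal (s * t ^ (s - 1 - 1)) * ENNReal.ofReal t := by
    rw [← ENNReal.ofReal_mul (by positivity)]
    congr 1
    rw [Real.rpow_sub_one ht0.ne' (s - 1)]
    field_simp
  have h3 : ENNReal.ofReal (s * t ^ (s - 1 - 1)) =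
      ENNReal.ofReal (s / (s - 1)) * ENNReal.ofReal ((s - 1) * t ^ (s - 1 - 1)) := by
    rw [← ENNReal.ofReal_mul (by positivity)]
    congr 1
    field_simp
  calc _ ≤ ENNReal.ofReal (s * t ^ (s - 1 - 1)) * (5 ^ d * ∫⁻ y in {y | ENNReal.ofReal t < g y}, g y) := by
        rw [h2, mul_assoc]; gcongr
    _ = _ := by rw [h3]; ring

theorem eLpNormE_eq {α : Type*} [MeasurableSpace α] (g : α → ℝ≥0∞) (p : ℝ≥0∞) (hp : p ≠ 0)
    (μ : Measure α) : eLpNormE g p μ = eLpNorm g p μ := by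
  unfold eLpNormE
  split_ifs with h
  · subst h
    simp [eLpNorm_exponent_top, eLpNormEssSup]
  · rw [eLpNorm_eq_lintegral_rpow_enorm_toReal hp h]
    simp

theorem eLpNormE_mono {α : Type*} [MeasurableSpace α] (f g : α → ℝ≥0∞) (p : ℝ≥0∞)
    (μ : Measure α) (h : ∀ x, f x ≤ g x) : eLpNormE f p μ ≤ eLpNormE g p μ := by
  unfold eLpNormE
  split_ifs with hp
  · exact essSup_mono_ae (Eventually.of_forall h)
  · gcongr; exact h _

theorem eLpNormE_tsum {α : Type*} [MeasurableSpace α] (g : ℕ → α → ℝ≥0∞) (p : ℝ≥0∞) (hp : 1 ≤ p)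
    (μ : Measure α) (hg : ∀ k, Measurable (g k)) :
    eLpNormE (fun x => ∑' k, g k x) p μ ≤ ∑' k, eLpNormE (g k) p μ := by
  have hp0 : p ≠ 0 := (zero_lt_one.trans_le hp).ne'
  by_cases h : p = ∞
  · simp only [eLpNormE, h, if_true]
    refine essSup_le_of_ae_le _ ?_
    have : ∀ᵐ x ∂μ, ∀ k, g k x ≤ essSup (g k) μ := ae_all_iff.2 fun k => ENNReal.ae_le_essSup _
    filter_upwards [this] with x hx
    exact ENNReal.tsum_le_tsum hx
  have hpr : 0 < p.toReal := ENNReal.toReal_pos hp0 h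
  have fin : ∀ n, eLpNormE (fun x => ∑ k ∈ Finset.range n, g k x) p μ ≤ ∑' k, eLpNormE (g k) p μ := by
    intro n
    refine le_trans ?_ (ENNReal.sum_le_tsum (Finset.range n))
    simp_rw [eLpNormE_eq _ p hp0]
    refine le_trans (le_of_eq ?_) (eLpNorm_sum_le (fun i _ => (hg i).aestronglyMeasurable) hp)
    congr 1
    ext x; simp
  have key : (∫⁻ x, (∑' k, g k x) ^ p.toReal ∂μ) ≤ (∑' k, eLpNormE (g k) p μ) ^ p.toReal := by
    have e : ∀ x, (∑' k, g k x) ^ p.toReal = ⨆ n, (∑ k ∈ Finset.range n, g k x) ^ p.toReal := by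
      intro x
      rw [ENNReal.tsum_eq_iSup_nat]
      exact (ENNReal.orderIsoRpow p.toReal hpr).map_iSup _
    simp_rw [e]
    rw [lintegral_iSup]
    · refine iSup_le fun n => ?_
      have := fin n
      simp only [eLpNormE, h, if_false] at this ⊢
      simp only [one_div] at this ⊢
      rwa [ENNReal.rpow_inv_le_iff hpr] at this
    · intro n
      have := fun k => hg k
      fun_prop
    · intro m n hmn x
      simp only
      gcongr
  simp only [eLpNormE, h, if_false] at key ⊢
  simp only [one_div] at key ⊢
  rwa [ENNReal.rpow_inv_le_iff hpr]

theorem eLpNormE_const_mul {α : Type*} [MeasurableSpace α] (g : α → ℝ≥0∞) (p : ℝ≥0∞) (hp : 1 ≤ p)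
    (μ : Measure α) (hg : Measurable g) (c : ℝ≥0∞) :
    eLpNormE (fun x => c * g x) p μ = c * eLpNormE g p μ := by
  have hp0 : p ≠ 0 := (zero_lt_one.trans_le hp).ne'
  unfold eLpNormE
  split_ifs with h
  · exact ENNReal.essSup_const_mul
  have hpr : 0 < p.toReal := ENNReal.toReal_pos hp0 h
  simp_rw [ENNReal.mul_rpow_of_nonneg _ _ hpr.le]
  rw [lintegral_const_mul _ (by fun_prop), ENNReal.mul_rpow_of_nonneg _ _ (by positivity),
    ← ENNReal.rpow_mul, mul_one_div_cancel hpr.ne', ENNReal.rpow_one]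

theorem vol_scale {d : ℕ} (x y : Rd d) (Λ r : ℝ) (hΛ : 0 < Λ) (k : ℕ) :
    volume (Metric.ball x (Λ ^ k * r)) =
      (ENNReal.ofReal Λ ^ d) ^ k * volume (Metric.ball y r) := by
  rw [Measure.addHaar_ball_mul_of_pos _ _ (by positivity : 0 < Λ ^ k),
    Measure.addHaar_ball_center _ y r]
  simp only [finrank_euclideanSpace, Fintype.card_fin]
  rw [ENNReal.ofReal_pow (by positivity), ENNReal.ofReal_pow hΛ.le, ← pow_mul, ← pow_mul, mul_comm d k]

theorem holder_ball {d : ℕ} (s : ℝ) (hs : 1 < s) (g : Rd d → ℝ≥0∞) (hg : Measurable g)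
    (B : Set (Rd d)) :
    ∫⁻ y in B, g y ≤ (∫⁻ y in B, g y ^ s) ^ (1 / s) * volume B ^ (1 - 1 / s) := by
  have h := ENNReal.lintegral_mul_le_Lp_mul_Lq (volume.restrict B)
    (Real.HolderConjugate.conjExponent hs) (f := g) (g := fun _ => 1) hg.aemeasurable
    aemeasurable_const
  have e : 1 / s.conjExponent = 1 - 1 / s := by
    rw [Real.conjExponent]
    have : s - 1 ≠ 0 := by linarith
    field_simp
  simpa [e] using h

theorem local_bound {d : ℕ} (s : ℝ) (hs : 1 < s) (f : Rd d → ℂ) (hf : Measurable f)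
    (Λ r : ℝ) (hΛ : 2 ≤ Λ) (hr : 0 < r) (y x : Rd d) (hx : x ∈ Metric.ball y r) :
    hlMax d f x ≤ uMax ((Metric.ball y (Λ ^ 1 * r)).indicator (fun z => ‖f z‖ₑ)) x +
      (ENNReal.ofReal Λ ^ d) ^ 2 * (volume (Metric.ball y r) ^ (1 / s))⁻¹ *
      ∑' k : ℕ, (((ENNReal.ofReal Λ ^ d) ^ k) ^ (1 / s))⁻¹ *
        (∫⁻ z in Metric.ball y (Λ ^ k * r), ‖f z‖ₑ ^ s) ^ (1 / s) := by
  have hΛ0 : 0 < Λ := by linarith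
  have hxy : dist x y < r := hx
  unfold hlMax
  refine iSup_le fun ⟨t, ht⟩ => ?_
  simp only
  have hg : Measurable (fun z => ‖f z‖ₑ) := by fun_prop
  rcases lt_or_ge t r with htr | htr
  · refine le_trans ?_ le_self_add
    refine le_trans ?_ (le_iSup _ (⟨x, ⟨t, ht⟩⟩ : Rd d × {r : ℝ // 0 < r}))
    simp only
    rw [Set.indicator_of_mem (Metric.mem_ball_self ht)]
    refine mul_le_mul_right (le_of_eq ?_) _
    apply setLIntegral_congr_fun measurableSet_ball
    intro z hz
    have : z ∈ Metric.ball y (Λ ^ 1 * r) := by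
      have h1 : dist z x < t := hz
      have := dist_triangle z x y
      rw [Metric.mem_ball, pow_one]
      nlinarith
    simp only [Set.indicator_of_mem this]
    rfl
  · refine le_trans ?_ le_add_self
    obtain ⟨k, hk1, hk2⟩ := exists_nat_pow_near (x := t / r) (y := Λ)
      ((one_le_div hr).2 htr) (by linarith)
    rw [le_div_iff₀ hr] at hk1
    rw [div_lt_iff₀ hr] at hk2
    set L := ENNReal.ofReal Λ ^ d with hL
    have hL0 : L ≠ 0 := by
      simp [hL, hΛ0]
    have hLt : L ≠ ∞ := by finiteness
    set V := volume (Metric.ball y r) with hV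
    have hV0 : V ≠ 0 := (Metric.measure_ball_pos _ _ hr).ne'
    have hVt : V ≠ ∞ := measure_ball_lt_top.ne
    set N := fun k : ℕ => (∫⁻ z in Metric.ball y (Λ ^ k * r), ‖f z‖ₑ ^ s) ^ (1 / s) with hN
    have hsub : Metric.ball x t ⊆ Metric.ball y (Λ ^ (k + 2) * r) := by
      intro z hz
      have h1 : dist z x < t := hz
      have := dist_triangle z x y
      have h2 : Λ ^ (k + 2) * r = Λ * (Λ ^ (k + 1) * r) := by ring
      rw [Metric.mem_ball, h2]
      nlinarith
    have hW : volume (Metric.ball y (Λ ^ (k + 2) * r)) = L ^ (k + 2) * V := vol_scale y y Λ r hΛ0 _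
    have hW0 : L ^ (k + 2) * V ≠ 0 := mul_ne_zero (pow_ne_zero _ hL0) hV0
    have hWt : L ^ (k + 2) * V ≠ ∞ := by finiteness
    calc (volume (Metric.ball x t))⁻¹ * ∫⁻ z in Metric.ball x t, ‖f z‖ₑ
        ≤ (volume (Metric.ball x (Λ ^ k * r)))⁻¹ *
            ∫⁻ z in Metric.ball y (Λ ^ (k + 2) * r), ‖f z‖ₑ := by
          gcongr
      _ ≤ (L ^ k * V)⁻¹ * (N (k + 2) * (L ^ (k + 2) * V) ^ (1 - 1 / s)) := by
          rw [vol_scale x y Λ r hΛ0]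
          gcongr
          rw [← hW]
          exact holder_ball s hs _ hg _
      _ = L ^ 2 * (V ^ (1 / s))⁻¹ * (((L ^ (k + 2)) ^ (1 / s))⁻¹ * N (k + 2)) := by
          rw [ENNReal.rpow_sub _ _ hW0 hWt, ENNReal.rpow_one,
            ENNReal.mul_rpow_of_nonneg _ _ (by positivity : 0 ≤ 1 / s), div_eq_mul_inv,
            ENNReal.mul_inv (a := L ^ k) (Or.inr hVt) (Or.inl (by finiteness)),
            ENNReal.mul_inv (a := (L ^ (k + 2)) ^ (1 / s)) (Or.inr (by finiteness))
              (Or.inl (by finiteness)), pow_add]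
          have c1 : (L ^ k)⁻¹ * L ^ k = 1 := ENNReal.inv_mul_cancel (pow_ne_zero _ hL0) (by finiteness)
          have c2 : V⁻¹ * V = 1 := ENNReal.inv_mul_cancel hV0 hVt
          calc _ = ((L ^ k)⁻¹ * L ^ k) * (V⁻¹ * V) * (L ^ 2 * (V ^ (1 / s))⁻¹ *
                (((L ^ k * L ^ 2) ^ (1 / s))⁻¹ * N (k + 2))) := by ring
            _ = _ := by rw [c1, c2, one_mul, one_mul]
      _ ≤ _ := by
          gcongr
          exact ENNReal.le_tsum (f := fun k => ((L ^ k) ^ (1 / s))⁻¹ * N k) (k + 2)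

theorem norm_bound {d : ℕ} (s : ℝ) (hs : 1 < s) (f : Rd d → ℂ) (hf : Measurable f)
    (Λ r : ℝ) (hΛ : 2 ≤ Λ) (hr : 0 < r) (y : Rd d) :
    (∫⁻ x in Metric.ball y r, hlMax d f x ^ s) ^ (1 / s) ≤
      (2 * ((2 ^ s * (5 ^ d * ENNReal.ofReal (s / (s - 1)))) ^ (1 / s) *
        (ENNReal.ofReal Λ ^ d) ^ (1 / s) + (ENNReal.ofReal Λ ^ d) ^ 2)) *
      ∑' k : ℕ, (((ENNReal.ofReal Λ ^ d) ^ k) ^ (1 / s))⁻¹ *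
        (∫⁻ z in Metric.ball y (Λ ^ k * r), ‖f z‖ₑ ^ s) ^ (1 / s) := by
  have hΛ0 : 0 < Λ := by linarith
  have hs0 : 0 < s := by linarith
  have hi : 0 ≤ 1 / s := by positivity
  have hi1 : 1 / s ≤ 1 := by rw [div_le_one hs0]; exact hs.le
  have hlb := local_bound s hs f hf Λ r hΛ hr y
  set A := (2 ^ s * (5 ^ d * ENNReal.ofReal (s / (s - 1)))) with hA
  set L := ENNReal.ofReal Λ ^ d with hL
  have hL0 : L ≠ 0 := by simp [hL, hΛ0]
  have hLt : L ≠ ∞ := by finiteness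
  set V := volume (Metric.ball y r) with hV
  have hV0 : V ≠ 0 := (Metric.measure_ball_pos _ _ hr).ne'
  have hVt : V ≠ ∞ := measure_ball_lt_top.ne
  set N := fun k : ℕ => (∫⁻ z in Metric.ball y (Λ ^ k * r), ‖f z‖ₑ ^ s) ^ (1 / s) with hN
  set T := ∑' k : ℕ, ((L ^ k) ^ (1 / s))⁻¹ * N k with hT
  set u := (Metric.ball y (Λ ^ 1 * r)).indicator (fun z => ‖f z‖ₑ) with hu
  have hum : Measurable u := by
    apply Measurable.indicator (by fun_prop) measurableSet_ball
  set c := L ^ 2 * (V ^ (1 / s))⁻¹ * T with hc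
  have h1 : ∫⁻ x in Metric.ball y r, hlMax d f x ^ s ≤
      2 ^ s * (A * (∫⁻ z in Metric.ball y (Λ ^ 1 * r), ‖f z‖ₑ ^ s) + V * c ^ s) := by
    calc _ ≤ ∫⁻ x in Metric.ball y r, 2 ^ s * (uMax u x ^ s + c ^ s) := by
          apply setLIntegral_mono' measurableSet_ball
          intro x hx
          calc _ ≤ (uMax u x + c) ^ s := by gcongr; exact hlb x hx
            _ ≤ 2 ^ (s - 1) * (uMax u x ^ s + c ^ s) :=
              ENNReal.rpow_add_le_mul_rpow_add_rpow _ _ hs.le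
            _ ≤ _ := by
              gcongr
              · norm_num
              · linarith
      _ = 2 ^ s * ((∫⁻ x in Metric.ball y r, uMax u x ^ s) + c ^ s * V) := by
          rw [lintegral_const_mul' _ _ (by finiteness), lintegral_add_right _ measurable_const,
            lintegral_const, Measure.restrict_apply_univ]
      _ ≤ _ := by
          rw [mul_comm (c ^ s)]
          gcongr
          refine (setLIntegral_le_lintegral _ _).trans ((strong_type s hs u hum).trans ?_)
          refine mul_le_mul_right (le_of_eq ?_) _
          rw [← lintegral_indicator measurableSet_ball]
          congr 1
          ext x
          by_cases hx : x ∈ Metric.ball y (Λ ^ 1 * r)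
          · simp only [hu, Set.indicator_of_mem hx]
          · simp only [hu, Set.indicator_of_notMem hx, ENNReal.zero_rpow_of_pos hs0]
  have hrt : ∀ a : ℝ≥0∞, (a ^ s) ^ (1 / s) = a := by
    intro a
    rw [← ENNReal.rpow_mul, mul_one_div_cancel hs0.ne', ENNReal.rpow_one]
  calc _ ≤ (2 ^ s * (A * (∫⁻ z in Metric.ball y (Λ ^ 1 * r), ‖f z‖ₑ ^ s) + V * c ^ s)) ^ (1 / s) := by
        gcongr
    _ ≤ 2 * (A ^ (1 / s) * N 1 + V ^ (1 / s) * c) := by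
        rw [ENNReal.mul_rpow_of_nonneg _ _ hi, hrt]
        gcongr
        refine (ENNReal.rpow_add_le_add_rpow _ _ hi hi1).trans ?_
        rw [ENNReal.mul_rpow_of_nonneg A _ hi, ENNReal.mul_rpow_of_nonneg V _ hi, hrt]
    _ ≤ 2 * (A ^ (1 / s) * (L ^ (1 / s) * T) + L ^ 2 * T) := by
        refine mul_le_mul_right (add_le_add (mul_le_mul_right ?_ _) ?_) _
        · have h2 : ((L ^ 1) ^ (1 / s))⁻¹ * N 1 ≤ T :=
            ENNReal.le_tsum (f := fun k => ((L ^ k) ^ (1 / s))⁻¹ * N k) 1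
          rw [pow_one] at h2
          calc N 1 = (L ^ (1 / s) * (L ^ (1 / s))⁻¹) * N 1 := by
                rw [ENNReal.mul_inv_cancel, one_mul]
                · simp [ENNReal.rpow_eq_zero_iff, hL0, hLt]
                · finiteness
            _ ≤ _ := by rw [mul_assoc]; gcongr
        · apply le_of_eq
          rw [hc]
          calc _ = (V ^ (1 / s) * (V ^ (1 / s))⁻¹) * (L ^ 2 * T) := by ring
            _ = _ := by
              rw [ENNReal.mul_inv_cancel, one_mul]
              · simp [ENNReal.rpow_eq_zero_iff, hV0, hVt]
              · finiteness
    _ = _ := by ring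

theorem meas_N {d : ℕ} (s R : ℝ) (f : Rd d → ℂ) (hf : Measurable f) :
    Measurable (fun y => (∫⁻ z in Metric.ball y R, ‖f z‖ₑ ^ s) ^ (1 / s)) := by
  apply Measurable.pow_const
  have e : ∀ y, ∫⁻ z in Metric.ball y R, ‖f z‖ₑ ^ s =
      ∫⁻ z, {w : Rd d × Rd d | dist w.2 w.1 < R}.indicator (fun w => ‖f w.2‖ₑ ^ s) (y, z) := by
    intro y
    rw [← lintegral_indicator measurableSet_ball]
    rfl
  simp_rw [e]
  apply Measurable.lintegral_prod_right
  apply Measurable.indicator (by fun_prop)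
  exact measurableSet_lt (by fun_prop) (by fun_prop)

theorem inner_eq {d : ℕ} (q : ℝ≥0∞) (hq0 : q ≠ 0) (hqt : q ≠ ∞) (f : Rd d → ℂ) (R : ℝ) (y : Rd d) :
    eLpNorm ((Metric.ball y R).indicator f) q volume =
      (∫⁻ z in Metric.ball y R, ‖f z‖ₑ ^ q.toReal) ^ (1 / q.toReal) := by
  rw [eLpNorm_indicator_eq_eLpNorm_restrict measurableSet_ball,
    eLpNorm_eq_lintegral_rpow_enorm_toReal hq0 hqt]

theorem innerE_eq {d : ℕ} (q : ℝ≥0∞) (hq0 : q ≠ 0) (hqt : q ≠ ∞) (g : Rd d → ℝ≥0∞) (R : ℝ)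
    (y : Rd d) : eLpNormE ((Metric.ball y R).indicator g) q volume =
      (∫⁻ z in Metric.ball y R, g z ^ q.toReal) ^ (1 / q.toReal) := by
  rw [eLpNormE_eq _ _ hq0, eLpNorm_indicator_eq_eLpNorm_restrict measurableSet_ball,
    eLpNorm_eq_lintegral_rpow_enorm_toReal hq0 hqt]
  simp

/-- Theorem 3.1: if `1 < q ≤ p ≤ ∞`, `φ ∈ 𝒢_{q,p}` and
`∫_r^∞ φ(t)^q t^{dq/p - 1} dt ≤ C φ(r)^q r^{dq/p}` for all `r > 0`, then the
Hardy–Littlewood maximal operator is bounded on `(L^q,L^p)^φ(ℝ^d)`. -/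
theorem maximal_bounded_fofana (d : ℕ) (q p : ℝ≥0∞) (hq : 1 < q) (hqp : q ≤ p)
    (φ : ℝ → ℝ) (hφ : IsGqp d q p φ) (C : ℝ) (hC : 0 < C)
    (hint : ∀ r : ℝ, 0 < r →
      (∫⁻ t in Set.Ioi r,
          ENNReal.ofReal
            (φ t ^ q.toReal * t ^ ((d : ℝ) * q.toReal * (1 / p).toReal - 1))) ≤
        ENNReal.ofReal
          (C * (φ r ^ q.toReal * r ^ ((d : ℝ) * q.toReal * (1 / p).toReal)))) :
    ∃ C' : ℝ, 0 < C' ∧ ∀ f : Rd d → ℂ, Measurable f → fofanaNorm d f q p φ < ⊤ →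
      fofanaNormE d (hlMax d f) q p φ ≤ ENNReal.ofReal C' * fofanaNorm d f q p φ := by
  obtain ⟨K, hK, hdec⟩ := hφ.almost_decreasing
  set e := (d : ℝ) * (1 / p).toReal with he
  have hee : (d : ℝ) * q.toReal * (1 / p).toReal = e * q.toReal := by rw [he]; ring
  rw [hee] at hint
  have hq0 : q ≠ 0 := (zero_lt_one.trans hq).ne'
  have hp1 : 1 ≤ p := hq.le.trans hqp
  by_cases hqt : q = ∞
  · exfalso
    have h := decay_aux q.toReal e C K ENNReal.toReal_nonneg hC hK φ hφ.pos hdec 1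
      (Real.exp (C + 1)) one_pos (Real.one_le_exp (by linarith)) (hint 1 one_pos)
    simp only [hqt, ENNReal.toReal_top, Real.rpow_zero, Real.log_exp] at h
    linarith
  have hs : 1 < q.toReal := by
    rw [← ENNReal.toReal_one]
    exact (ENNReal.toReal_lt_toReal (by simp) hqt).2 hq
  set s := q.toReal with hsdef
  have hs0 : 0 < s := by linarith
  have hqs : (1 / q).toReal = 1 / s := by rw [ENNReal.toReal_div]; simp [hsdef]
  obtain ⟨Λ, hΛ, hdecay⟩ := decay s e C K hs0 hC hK φ hφ.pos hdec hint
  have hΛ0 : 0 < Λ := by linarith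
  set D := (2 * ((2 ^ s * (5 ^ d * ENNReal.ofReal (s / (s - 1)))) ^ (1 / s) *
        (ENNReal.ofReal Λ ^ d) ^ (1 / s) + (ENNReal.ofReal Λ ^ d) ^ 2)) with hD
  have hDt : D ≠ ∞ := by
    rw [hD]
    have : 0 ≤ 1 / s := by positivity
    finiteness
  refine ⟨(D * 2).toReal + 1, by positivity, fun f hf _ => ?_⟩
  have hDle : D * 2 ≤ ENNReal.ofReal ((D * 2).toReal + 1) := by
    conv_lhs => rw [← ENNReal.ofReal_toReal (a := D * 2) (by finiteness)]
    exact ENNReal.ofReal_le_ofReal (by linarith)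
  refine le_trans ?_ (mul_le_mul_left hDle _)
  set F := fofanaNorm d f q p φ with hF
  set N := fun (R : ℝ) (y : Rd d) => (∫⁻ z in Metric.ball y R, ‖f z‖ₑ ^ s) ^ (1 / s) with hN
  have hNm : ∀ R, Measurable (N R) := fun R => meas_N s R f hf
  have hFb : ∀ R : ℝ, 0 < R → eLpNormE (N R) p volume ≤
      ENNReal.ofReal (φ R * R ^ ((d : ℝ) * (1 / s) + e)) * F := by
    intro R hR
    have h1 : ENNReal.ofReal ((φ R)⁻¹ * R ^ ((d : ℝ) * (-(1 / q).toReal - (1 / p).toReal))) *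
        contAmalgam d f q p R ≤ F :=
      le_iSup (fun r : {r : ℝ // 0 < r} => ENNReal.ofReal ((φ r)⁻¹ * (r : ℝ) ^
        ((d : ℝ) * (-(1 / q).toReal - (1 / p).toReal))) * contAmalgam d f q p r) ⟨R, hR⟩
    have h2 : contAmalgam d f q p R = eLpNormE (N R) p volume := by
      unfold contAmalgam
      simp_rw [inner_eq q hq0 hqt f R]
      rfl
    rw [h2, hqs] at h1
    have hφR := hφ.pos R hR
    have h3 : φ R * R ^ ((d : ℝ) * (1 / s) + e) *
        ((φ R)⁻¹ * R ^ ((d : ℝ) * (-(1 / s) - (1 / p).toReal))) = 1 := by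
      have : (d : ℝ) * (-(1 / s) - (1 / p).toReal) = -((d : ℝ) * (1 / s) + e) := by rw [he]; ring
      rw [this, Real.rpow_neg hR.le]
      have : 0 < R ^ ((d : ℝ) * (1 / s) + e) := by positivity
      field_simp
    calc _ = ENNReal.ofReal 1 * eLpNormE (N R) p volume := by simp
      _ = ENNReal.ofReal (φ R * R ^ ((d : ℝ) * (1 / s) + e)) *
          (ENNReal.ofReal ((φ R)⁻¹ * R ^ ((d : ℝ) * (-(1 / s) - (1 / p).toReal))) *
            eLpNormE (N R) p volume) := by
          rw [← mul_assoc, ← ENNReal.ofReal_mul (by positivity), h3]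
      _ ≤ _ := by gcongr
  unfold fofanaNormE
  refine iSup_le fun ⟨r, hr⟩ => ?_
  simp only
  rw [hqs]
  have hφr := hφ.pos r hr
  set w := fun k : ℕ => (((ENNReal.ofReal Λ ^ d) ^ k) ^ (1 / s))⁻¹ with hw
  have hwk : ∀ k, w k = ENNReal.ofReal ((Λ ^ k) ^ (-((d : ℝ) * (1 / s)))) := by
    intro k
    have hpos : 0 < Λ ^ k := by positivity
    rw [hw]
    simp only
    rw [Real.rpow_neg hpos.le, ENNReal.ofReal_inv_of_pos (by positivity), Real.rpow_mul hpos.le,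
      Real.rpow_natCast, ← ENNReal.ofReal_rpow_of_nonneg (by positivity) (by positivity),
      ENNReal.ofReal_pow hpos.le, ENNReal.ofReal_pow hΛ0.le, ← pow_mul, ← pow_mul, mul_comm d k]
  have hA : contAmalgamE d (hlMax d f) q p r ≤
      D * ∑' k : ℕ, w k * eLpNormE (N (Λ ^ k * r)) p volume := by
    unfold contAmalgamE
    calc _ ≤ eLpNormE (fun y => D * ∑' k : ℕ, w k * N (Λ ^ k * r) y) p volume := by
          apply eLpNormE_mono
          intro y
          rw [innerE_eq q hq0 hqt]
          exact norm_bound s hs f hf Λ r hΛ hr y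
      _ = D * eLpNormE (fun y => ∑' k : ℕ, w k * N (Λ ^ k * r) y) p volume := by
          apply eLpNormE_const_mul _ _ hp1
          exact Measurable.tsum fun k => (hNm _).const_mul _
      _ ≤ D * ∑' k : ℕ, eLpNormE (fun y => w k * N (Λ ^ k * r) y) p volume := by
          gcongr
          exact eLpNormE_tsum (fun k y => w k * N (Λ ^ k * r) y) p hp1 _
            (fun k => (hNm _).const_mul _)
      _ = _ := by
          simp_rw [fun k => eLpNormE_const_mul (N (Λ ^ k * r)) p hp1 volume (hNm _) (w k)]
  have hB : ∀ k : ℕ, w k * eLpNormE (N (Λ ^ k * r)) p volume ≤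
      ENNReal.ofReal (φ r * r ^ ((d : ℝ) * (1 / s) + e)) * F * (2⁻¹) ^ k := by
    intro k
    have hpos : 0 < Λ ^ k := by positivity
    have hR : 0 < Λ ^ k * r := by positivity
    have hφR := hφ.pos _ hR
    calc _ ≤ w k * (ENNReal.ofReal (φ (Λ ^ k * r) * (Λ ^ k * r) ^ ((d : ℝ) * (1 / s) + e)) * F) := by
          gcongr
          exact hFb _ hR
      _ = ENNReal.ofReal (r ^ ((d : ℝ) * (1 / s)) * ((Λ ^ k * r) ^ e * φ (Λ ^ k * r))) * F := by
          rw [hwk, ← mul_assoc, ← ENNReal.ofReal_mul (by positivity)]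
          congr 2
          rw [Real.rpow_add hR, Real.mul_rpow hpos.le hr.le, Real.rpow_neg hpos.le]
          have : 0 < (Λ ^ k) ^ ((d : ℝ) * (1 / s)) := by positivity
          field_simp
      _ ≤ ENNReal.ofReal (r ^ ((d : ℝ) * (1 / s)) * ((1 / 2) ^ k * (r ^ e * φ r))) * F := by
          refine mul_le_mul_left (ENNReal.ofReal_le_ofReal ?_) _
          exact mul_le_mul_of_nonneg_left (hdecay r hr k) (by positivity)
      _ = ENNReal.ofReal ((φ r * r ^ ((d : ℝ) * (1 / s) + e)) * (1 / 2) ^ k) * F := by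
          congr 2
          rw [Real.rpow_add hr]
          ring
      _ = _ := by
          rw [ENNReal.ofReal_mul (by positivity), ENNReal.ofReal_pow (by positivity)]
          have : ENNReal.ofReal (1 / 2) = 2⁻¹ := by
            rw [one_div, ENNReal.ofReal_inv_of_pos (by norm_num)]; simp
          rw [this]; ring
  have hsum : ∑' k : ℕ, w k * eLpNormE (N (Λ ^ k * r)) p volume ≤
      ENNReal.ofReal (φ r * r ^ ((d : ℝ) * (1 / s) + e)) * F * 2 := by
    refine (ENNReal.tsum_le_tsum hB).trans (le_of_eq ?_)
    rw [ENNReal.tsum_mul_left, ENNReal.tsum_geometric_two]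
  have h3 : ((φ r)⁻¹ * r ^ ((d : ℝ) * (-(1 / s) - (1 / p).toReal))) *
      (φ r * r ^ ((d : ℝ) * (1 / s) + e)) = 1 := by
    have : (d : ℝ) * (-(1 / s) - (1 / p).toReal) = -((d : ℝ) * (1 / s) + e) := by rw [he]; ring
    rw [this, Real.rpow_neg hr.le]
    have : 0 < r ^ ((d : ℝ) * (1 / s) + e) := by positivity
    field_simp
  calc _ ≤ ENNReal.ofReal ((φ r)⁻¹ * r ^ ((d : ℝ) * (-(1 / s) - (1 / p).toReal))) *
        (D * (ENNReal.ofReal (φ r * r ^ ((d : ℝ) * (1 / s) + e)) * F * 2)) :=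
        mul_le_mul_right (hA.trans (mul_le_mul_right hsum _)) _
    _ = (ENNReal.ofReal ((φ r)⁻¹ * r ^ ((d : ℝ) * (-(1 / s) - (1 / p).toReal))) *
        ENNReal.ofReal (φ r * r ^ ((d : ℝ) * (1 / s) + e))) * (D * 2 * F) := by ring
    _ = D * 2 * F := by
        rw [← ENNReal.ofReal_mul (by positivity), h3, ENNReal.ofReal_one, one_mul]
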